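/- Let V be a finitely generated free ℚ-algebra-module as above, and let φ be an algebra automorphism of ΛV with (φ − Id)(Λ^j V) ⊆ ⊕_{k≥1} Λ^{j+2k} V for all j. Then log(φ) := Σ_{n≥1} (−1)^{n+1}(φ − Id)ⁿ/n (a finite sum) is a derivation of ΛV satisfying log(φ)(Λ^j V) ⊆ ⊕_{k≥1} Λ^{j+2k} V, and exp(log(φ)) = φ. -/

import Mathlib

open ExteriorAlgebra

/-- The logarithm `log (1 + X)` as a power series is inverse to the exponential. -/
theorem PowerSeries.exp_subst_log {A : Type*} [CommRing A] [Algebra ℚ A] [IsAddTorsionFree A] :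
    (PowerSeries.exp A).subst (PowerSeries.log A) = 1 + PowerSeries.X := by
  set F := (PowerSeries.exp A).subst (PowerSeries.log A) with hF
  set u := PowerSeries.derivative A (PowerSeries.log A) with hu
  have hFc : PowerSeries.constantCoeff F = 1 := by
    have h : F = (PowerSeries.exp A - 1).subst (PowerSeries.log A) + 1 := by
      rw [← PowerSeries.coe_substAlgHom PowerSeries.HasSubst.log, map_sub, map_one,
        sub_add_cancel, PowerSeries.coe_substAlgHom]
    rw [h, map_add, PowerSeries.constantCoeff_eq,
      PowerSeries.constantCoeff_subst_eq_zero PowerSeries.constantCoeff_log _ (by simp)]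
    simp
  have hXu : (1 + PowerSeries.X) * u = 1 := by
    rw [hu, PowerSeries.deriv_log]
    ext n
    cases n with
    | zero => simp [add_mul]
    | succ n =>
      simp [add_mul, PowerSeries.coeff_succ_X_mul, PowerSeries.coeff_one, pow_succ]
  have hdF : PowerSeries.derivative A F = F * u := by
    rw [hF, PowerSeries.derivative_subst PowerSeries.HasSubst.log, PowerSeries.derivative_exp]
  have hdu : PowerSeries.derivative A u = -(u * u) := by
    have h := congrArg (PowerSeries.derivative A) hXu
    simp only [Derivation.leibniz, map_add, PowerSeries.derivative_X, PowerSeries.derivative_one,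
      smul_eq_mul] at h
    linear_combination u * h - PowerSeries.derivative A u * hXu
  have hFu : F * u = 1 := by
    apply PowerSeries.derivative.ext
    · simp only [Derivation.leibniz, smul_eq_mul, hdF, hdu, PowerSeries.derivative_one]
      ring
    · rw [map_mul, hFc, hu, PowerSeries.deriv_log]
      simp
  linear_combination (1 + PowerSeries.X) * hFu - F * hXu

open Polynomial in
/-- Composing the truncated exponential with the truncated logarithm gives `1 + X` up to the order
of truncation. -/
theorem Polynomial.X_pow_dvd_trunc_exp_comp_trunc_log_sub (N : ℕ) :
    (X : ℚ[X]) ^ N ∣ ((PowerSeries.exp ℚ).trunc N).comp ((PowerSeries.log ℚ).trunc (N + 1)) -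
      (1 + X) := by
  set l := PowerSeries.log ℚ
  set P := l.trunc (N + 1)
  set E := (PowerSeries.exp ℚ).trunc N
  rw [Polynomial.X_pow_dvd_iff]
  have key : (PowerSeries.X : PowerSeries ℚ) ^ N ∣ ((E.comp P - (1 + X) : ℚ[X]) : PowerSeries ℚ) := by
    have h1 : (PowerSeries.X : PowerSeries ℚ) ^ N ∣ (P : PowerSeries ℚ) - l := by
      rw [PowerSeries.X_pow_dvd_iff]
      intro m hm
      simp [P, PowerSeries.coeff_trunc, show m < N + 1 by omega]
    have h2 : (PowerSeries.X : PowerSeries ℚ) ^ N ∣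
        aeval (P : PowerSeries ℚ) E - aeval l E :=
      h1.trans (by simpa [aeval_def, eval₂_eq_eval_map] using
        Polynomial.sub_dvd_eval_sub (P : PowerSeries ℚ) l (E.map (algebraMap ℚ (PowerSeries ℚ))))
    have h3 : (PowerSeries.X : PowerSeries ℚ) ^ N ∣ PowerSeries.exp ℚ - (E : PowerSeries ℚ) := by
      rw [PowerSeries.X_pow_dvd_iff]
      intro m hm
      simp [E, PowerSeries.coeff_trunc, hm]
    have h4 : (PowerSeries.X : PowerSeries ℚ) ^ N ∣ aeval l E - (1 + PowerSeries.X) := by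
      obtain ⟨s, hs⟩ := h3
      have h := congrArg (PowerSeries.substAlgHom (R := ℚ)
        (PowerSeries.HasSubst.log (A := ℚ))) hs
      rw [map_sub, map_mul, map_pow, PowerSeries.substAlgHom_X, PowerSeries.coe_substAlgHom,
        PowerSeries.exp_subst_log, PowerSeries.subst_coe PowerSeries.HasSubst.log] at h
      have hX : (PowerSeries.X : PowerSeries ℚ) ∣ l := by
        rw [PowerSeries.X_dvd_iff]; exact PowerSeries.constantCoeff_log
      rw [← dvd_neg, neg_sub, h]
      exact (pow_dvd_pow_of_dvd hX N).mul_right _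
    have h5 : ((E.comp P - (1 + X) : ℚ[X]) : PowerSeries ℚ) =
        aeval (P : PowerSeries ℚ) E - (1 + PowerSeries.X) := by
      have h : ((E.comp P : ℚ[X]) : PowerSeries ℚ) = aeval (P : PowerSeries ℚ) E := by
        simpa [Polynomial.comp_eq_aeval, Polynomial.coeToPowerSeries.algHom_apply] using
          (Polynomial.aeval_algHom_apply (Polynomial.coeToPowerSeries.algHom ℚ) P E).symm
      simp [h]
    rw [h5, ← sub_add_sub_cancel _ (aeval l E)]
    exact dvd_add h2 h4
  rw [PowerSeries.X_pow_dvd_iff] at key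
  intro d hd
  rw [← Polynomial.coeff_coe]
  exact key d hd

namespace IsNilpotent

section Log

variable {A : Type*} [Ring A]

open Finset

/-- The logarithm `log (1 + a)`, defined in analogy with the usual logarithm series.
It provides meaningful (non-junk) values for nilpotent elements. -/
noncomputable def logOneAdd [Module ℚ A] (a : A) : A :=
  ∑ n ∈ range (nilpotencyClass a), ((-1 : ℚ) ^ n / (n + 1)) • a ^ (n + 1)

theorem logOneAdd_eq_sum [Module ℚ A] {a : A} {k : ℕ} (h : a ^ k = 0) :
    logOneAdd a = ∑ n ∈ range k, ((-1 : ℚ) ^ n / (n + 1)) • a ^ (n + 1) := by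
  refine sum_subset (range_mono (csInf_le' h)) fun n _ hn ↦ ?_
  rw [mem_range, not_lt] at hn
  rw [pow_eq_zero_of_le (hn.trans n.le_succ) (pow_nilpotencyClass ⟨k, h⟩), smul_zero]

theorem commute_logOneAdd_right [Algebra ℚ A] {a b : A} (h : Commute b a) :
    Commute b (logOneAdd a) :=
  Commute.sum_right _ _ _ fun n _ ↦ (h.pow_right (n + 1)).smul_right _

theorem logOneAdd_eq_aeval_trunc_log [Algebra ℚ A] {a : A} {k : ℕ} (h : a ^ k = 0) :
    logOneAdd a = Polynomial.aeval a ((PowerSeries.log ℚ).trunc (k + 1)) := by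
  rw [logOneAdd_eq_sum h, Polynomial.aeval_def, PowerSeries.eval₂_trunc_eq_sum_range,
    sum_range_succ']
  simp [Algebra.smul_def, _root_.pow_succ (-1 : ℚ)]

theorem logOneAdd_pow_eq_zero [Algebra ℚ A] {a : A} {k : ℕ} (h : a ^ k = 0) :
    logOneAdd a ^ k = 0 := by
  have hX : (Polynomial.X : Polynomial ℚ) ∣ (PowerSeries.log ℚ).trunc (k + 1) := by
    simp [Polynomial.X_dvd_iff, PowerSeries.coeff_trunc]
  obtain ⟨q, hq⟩ := pow_dvd_pow_of_dvd hX k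
  rw [logOneAdd_eq_aeval_trunc_log h, ← map_pow, hq, map_mul, map_pow, Polynomial.aeval_X, h,
    zero_mul]

theorem isNilpotent_logOneAdd [Algebra ℚ A] {a : A} (h : IsNilpotent a) :
    IsNilpotent (logOneAdd a) :=
  h.imp fun _ ↦ logOneAdd_pow_eq_zero

theorem exp_logOneAdd [Algebra ℚ A] {a : A} (h : IsNilpotent a) :
    exp (logOneAdd a) = 1 + a := by
  obtain ⟨k, hk⟩ := h
  have hE (b : A) : ∑ i ∈ range k, (i.factorial : ℚ)⁻¹ • b ^ i =
      Polynomial.aeval b ((PowerSeries.exp ℚ).trunc k) := by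
    rw [Polynomial.aeval_def, PowerSeries.eval₂_trunc_eq_sum_range]
    simp [Algebra.smul_def, PowerSeries.coeff_exp]
  rw [exp_eq_sum (logOneAdd_pow_eq_zero hk), hE, logOneAdd_eq_aeval_trunc_log hk,
    ← Polynomial.aeval_comp, ← sub_eq_zero]
  obtain ⟨q, hq⟩ := Polynomial.X_pow_dvd_trunc_exp_comp_trunc_log_sub k
  simpa [hk] using congrArg (Polynomial.aeval a) hq

theorem eq_zero_of_exp_eq_one [Algebra ℚ A] {a : A} (h : IsNilpotent a) (ha : exp a = 1) :
    a = 0 := by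
  obtain ⟨k, hk⟩ := h
  have hk2 : a ^ (k + 2) = 0 := pow_eq_zero_of_le (by omega) hk
  set w := ∑ i ∈ range k, ((i + 2).factorial : ℚ)⁻¹ • a ^ i
  have hw : Commute a w := Commute.sum_right _ _ _ fun i _ ↦
    ((Commute.refl a).pow_right i).smul_right _
  have hsum : exp a = a * (1 + a * w) + 1 := by
    rw [exp_eq_sum hk2, sum_range_succ', sum_range_succ']
    simp only [w, mul_add, mul_sum, mul_smul_comm, pow_succ']
    simp only [Nat.factorial_zero, Nat.factorial_one, Nat.cast_one, inv_one, pow_zero, mul_one,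
      one_smul, zero_add]
    abel
  have hu : IsUnit (1 + a * w) := (hw.isNilpotent_mul_right ⟨k, hk⟩).isUnit_one_add
  rw [ha, right_eq_add] at hsum
  exact hu.mul_left_eq_zero.1 hsum

theorem eq_of_exp_eq_of_commute [Algebra ℚ A] {a b : A} (h : Commute a b) (ha : IsNilpotent a)
    (hb : IsNilpotent b) (hab : exp a = exp b) : a = b := by
  rw [← sub_eq_zero]
  refine eq_zero_of_exp_eq_one (h.isNilpotent_sub ha hb) ?_
  rw [sub_eq_add_neg, exp_add_of_commute h.neg_right ha hb.neg, hab, exp_mul_exp_neg_self hb]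

end Log

end IsNilpotent

namespace Module.End

open _root_.IsNilpotent TensorProduct

theorem commute_logOneAdd_left_of_commute {R M N : Type*} [CommRing R] [AddCommGroup M]
    [Module R M] [AddCommGroup N] [Module R N] [Module ℚ M] [Module ℚ N]
    {fM : Module.End R M} {fN : Module.End R N} {g : M →ₗ[R] N}
    (hfM : IsNilpotent fM) (hfN : IsNilpotent fN) (h : fN ∘ₗ g = g ∘ₗ fM) :
    logOneAdd fN ∘ₗ g = g ∘ₗ logOneAdd fM := by
  ext m
  obtain ⟨k, hfM⟩ := hfM
  obtain ⟨l, hfN⟩ := hfN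
  replace hfM : fM ^ (max k l) = 0 := pow_eq_zero_of_le (le_max_left _ _) hfM
  replace hfN : fN ^ (max k l) = 0 := pow_eq_zero_of_le (le_max_right _ _) hfN
  have (i : ℕ) : (fN ^ i) (g m) = g ((fM ^ i) m) := by
    simpa using LinearMap.congr_fun (Module.End.commute_pow_left_of_commute h i) m
  simp [logOneAdd_eq_sum hfM, logOneAdd_eq_sum hfN, this, map_rat_smul]

/-- The logarithm of a unipotent algebra endomorphism is a derivation. -/
theorem logOneAdd_sub_one_mul {R B : Type*} [CommRing R] [Ring B] [Algebra R B] [Algebra ℚ R]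
    [Algebra ℚ B] [IsScalarTower ℚ R B] (φ : B →ₐ[R] B)
    (hφ : IsNilpotent (φ.toLinearMap - 1 : Module.End R B)) (x y : B) :
    logOneAdd (φ.toLinearMap - 1 : Module.End R B) (x * y) =
      logOneAdd (φ.toLinearMap - 1 : Module.End R B) x * y +
        x * logOneAdd (φ.toLinearMap - 1 : Module.End R B) y := by
  set δ : Module.End R B := φ.toLinearMap - 1 with hδ
  set L := logOneAdd δ
  have hL : IsNilpotent L := isNilpotent_logOneAdd hφ
  have hexp : exp L = φ.toLinearMap := by rw [exp_logOneAdd hφ, hδ, add_sub_cancel]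
  have hLφ : Commute φ.toLinearMap L := by
    refine commute_logOneAdd_right ?_
    exact (Commute.refl _).sub_right (Commute.one_right _)
  let DL : Module.End R (B ⊗[R] B) := L.lTensor B
  let DR : Module.End R (B ⊗[R] B) := L.rTensor B
  let Φ : Module.End R (B ⊗[R] B) := TensorProduct.map φ.toLinearMap φ.toLinearMap
  have hDL : IsNilpotent DL := hL.map <| lTensorAlgHom R B B
  have hDR : IsNilpotent DR := hL.map <| rTensorAlgHom R B B
  have hcomm : Commute DL DR := by ext; simp [DL, DR]
  have hD : IsNilpotent (DL + DR) := hcomm.isNilpotent_add hDL hDR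
  have hexpD : exp (DL + DR) = Φ := by
    have h₂ : exp DL = (exp L).lTensor B := (hL.map_exp (lTensorAlgHom R B B)).symm
    have h₃ : exp DR = (exp L).rTensor B := (hL.map_exp (rTensorAlgHom R B B)).symm
    rw [exp_add_of_commute hcomm hDL hDR, h₂, h₃, hexp]
    ext; simp [Φ]
  have hΦ : IsNilpotent (Φ - 1) := hexpD ▸ isNilpotent_exp_sub_one hD
  have hΦD : Commute (DL + DR) (Φ - 1) := by
    refine Commute.sub_right ?_ (Commute.one_right _)
    have h (z : B) : φ (L z) = L (φ z) := LinearMap.congr_fun hLφ z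
    refine Commute.add_left ?_ ?_ <;> ext <;> simp [DL, DR, Φ, h]
  have hlog : logOneAdd (Φ - 1) = DL + DR := by
    refine (eq_of_exp_eq_of_commute (commute_logOneAdd_right hΦD) hD
      (isNilpotent_logOneAdd hΦ) ?_).symm
    rw [exp_logOneAdd hΦ, hexpD, add_sub_cancel]
  have hmul : L ∘ₗ LinearMap.mul' R B = LinearMap.mul' R B ∘ₗ logOneAdd (Φ - 1) := by
    refine commute_logOneAdd_left_of_commute hΦ hφ ?_
    ext; simp [δ, Φ]
  simpa [hlog, DL, DR, add_comm] using LinearMap.congr_fun hmul (x ⊗ₜ[R] y)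

end Module.End

namespace exteriorPower

theorem eq_bot_of_card_lt {R M I : Type*} [CommRing R] [AddCommGroup M] [Module R M] [Fintype I]
    (b : Module.Basis I R M) {n : ℕ} (h : Fintype.card I < n) : ⋀[R]^n M = ⊥ := by
  let b' := b.reindex (Fintype.equivFin I)
  have hspan := ιMulti_family_span_fixedDegree_of_span (R := R) (n := n) b'.span_eq
  have : IsEmpty (Set.powersetCard (Fin (Fintype.card I)) n) := by
    rw [Set.isEmpty_coe_sort]
    ext s
    have := s.card_le_univ
    simp at this
    simp [Set.powersetCard]
    omega
  rw [← hspan, Set.range_eq_empty, Submodule.span_empty]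

end exteriorPower

namespace ExteriorAlgebra

variable {R V : Type*} [CommRing R] [AddCommGroup V] [Module R V]

theorem pow_apply_mem_iSup_exteriorPower {δ : Module.End R (ExteriorAlgebra R V)}
    (hδ : ∀ j : ℕ, ∀ x ∈ ⋀[R]^j V, δ x ∈ ⨆ k : ℕ, ⋀[R]^(j + 2 + 2 * k) V)
    (n : ℕ) {j : ℕ} {x : ExteriorAlgebra R V} (hx : x ∈ ⋀[R]^j V) :
    (δ ^ n) x ∈ ⨆ k : ℕ, ⋀[R]^(j + 2 * n + 2 * k) V := by
  induction n with
  | zero => exact Submodule.mem_iSup_of_mem 0 (by simpa using hx)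
  | succ n ih =>
    rw [pow_succ', Module.End.mul_apply]
    have hle : ⨆ k : ℕ, ⋀[R]^(j + 2 * n + 2 * k) V ≤
        (⨆ k : ℕ, ⋀[R]^(j + 2 * (n + 1) + 2 * k) V).comap δ := by
      refine iSup_le fun k y hy ↦ ?_
      refine (iSup_le fun i ↦ ?_ : _ ≤ ⨆ k : ℕ, ⋀[R]^(j + 2 * (n + 1) + 2 * k) V) (hδ _ y hy)
      refine le_iSup_of_le (k + i) ?_
      rw [show j + 2 * n + 2 * k + 2 + 2 * i = j + 2 * (n + 1) + 2 * (k + i) by ring]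
    exact hle ih

theorem pow_succ_apply_mem_iSup_exteriorPower {δ : Module.End R (ExteriorAlgebra R V)}
    (hδ : ∀ j : ℕ, ∀ x ∈ ⋀[R]^j V, δ x ∈ ⨆ k : ℕ, ⋀[R]^(j + 2 + 2 * k) V)
    (n : ℕ) {j : ℕ} {x : ExteriorAlgebra R V} (hx : x ∈ ⋀[R]^j V) :
    (δ ^ (n + 1)) x ∈ ⨆ k : ℕ, ⋀[R]^(j + 2 + 2 * k) V := by
  refine (iSup_le fun k ↦ le_iSup_of_le (n + k) ?_ :
    _ ≤ ⨆ k : ℕ, ⋀[R]^(j + 2 + 2 * k) V) (pow_apply_mem_iSup_exteriorPower hδ (n + 1) hx)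
  rw [show j + 2 * (n + 1) + 2 * k = j + 2 + 2 * (n + k) by ring]

theorem isNilpotent_of_raises_degree [Module.Free R V] [Module.Finite R V]
    {δ : Module.End R (ExteriorAlgebra R V)}
    (hδ : ∀ j : ℕ, ∀ x ∈ ⋀[R]^j V, δ x ∈ ⨆ k : ℕ, ⋀[R]^(j + 2 + 2 * k) V) :
    IsNilpotent δ := by
  classical
  let b := Module.Free.chooseBasis R V
  refine ⟨Fintype.card (Module.Free.ChooseBasisIndex R V) + 1, ?_⟩
  set r := Fintype.card (Module.Free.ChooseBasisIndex R V)
  rw [← LinearMap.ker_eq_top, eq_top_iff,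
    ← (DirectSum.Decomposition.isInternal fun i : ℕ ↦ ⋀[R]^i V).submodule_iSup_eq_top]
  refine iSup_le fun j x hx ↦ ?_
  have h := pow_apply_mem_iSup_exteriorPower hδ (r + 1) hx
  have hbot : ⨆ k : ℕ, ⋀[R]^(j + 2 * (r + 1) + 2 * k) V = ⊥ :=
    iSup_eq_bot.2 fun k ↦ exteriorPower.eq_bot_of_card_lt b (by omega)
  rwa [hbot, Submodule.mem_bot] at h

end ExteriorAlgebra

/-- **Logarithm of a degree-raising automorphism.** Let `R` be a ℚ-algebra and `V` a finitely
generated free `R`-module. If `φ` is an algebra automorphism of `ΛV` with `φ − Id` raising the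
grading by at least 2, then `φ − Id` is nilpotent, the (finite) logarithm
`log(φ) = Σ_{n≥1} (−1)^{n+1}(φ − Id)ⁿ/n` is a derivation of `ΛV` raising the grading by at
least 2, and `exp(log(φ)) = φ`. -/
theorem log_of_degree_raising_automorphism {R V : Type*} [CommRing R] [Algebra ℚ R]
    [AddCommGroup V] [Module R V] [Module.Free R V] [Module.Finite R V]
    (φ : ExteriorAlgebra R V ≃ₐ[R] ExteriorAlgebra R V)
    (hdeg : ∀ (j : ℕ), ∀ x ∈ ⋀[R]^j V,
      φ x - x ∈ ⨆ k : ℕ, ⋀[R]^(j + 2 * (k + 1)) V) :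
    ∃ N : ℕ, (φ.toLinearMap - LinearMap.id : Module.End R (ExteriorAlgebra R V)) ^ N = 0 ∧
      ∃ L : Module.End R (ExteriorAlgebra R V),
        (∀ x : ExteriorAlgebra R V,
          L x = ∑ n ∈ Finset.range N, algebraMap ℚ R ((-1 : ℚ) ^ n / (n + 1)) •
            (((φ.toLinearMap - LinearMap.id : Module.End R (ExteriorAlgebra R V)) ^ (n + 1)) x)) ∧
        (∀ x y : ExteriorAlgebra R V, L (x * y) = L x * y + x * L y) ∧
        (∀ (j : ℕ), ∀ x ∈ ⋀[R]^j V, L x ∈ ⨆ k : ℕ, ⋀[R]^(j + 2 * (k + 1)) V) ∧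
        ∃ M : ℕ, L ^ M = 0 ∧
          ∀ x : ExteriorAlgebra R V,
            φ x = ∑ n ∈ Finset.range M, algebraMap ℚ R ((n.factorial : ℚ)⁻¹) • (L ^ n) x := by
  set δ : Module.End R (ExteriorAlgebra R V) := φ.toLinearMap - LinearMap.id with hδ
  have hadd (j k : ℕ) : j + 2 * (k + 1) = j + 2 + 2 * k := by ring
  simp only [hadd] at hdeg ⊢
  let _ : Algebra ℚ (ExteriorAlgebra R V) := Algebra.compHom _ (algebraMap ℚ R)
  have : IsScalarTower ℚ R (ExteriorAlgebra R V) := IsScalarTower.of_algebraMap_eq fun _ ↦ rfl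
  have hnil : IsNilpotent δ := isNilpotent_of_raises_degree hdeg
  obtain ⟨N, hN⟩ := hnil
  have hL (x : ExteriorAlgebra R V) : IsNilpotent.logOneAdd δ x =
      ∑ n ∈ Finset.range N, algebraMap ℚ R ((-1 : ℚ) ^ n / (n + 1)) • (δ ^ (n + 1)) x := by
    simp only [IsNilpotent.logOneAdd_eq_sum hN, LinearMap.sum_apply, LinearMap.smul_apply,
      algebraMap_smul]
  refine ⟨N, hN, IsNilpotent.logOneAdd δ, hL,
    Module.End.logOneAdd_sub_one_mul φ.toAlgHom ⟨N, hN⟩, fun j x hx ↦ ?_, N,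
    IsNilpotent.logOneAdd_pow_eq_zero hN, fun x ↦ ?_⟩
  · rw [hL]
    exact Submodule.sum_mem _ fun n _ ↦
      Submodule.smul_mem _ _ (pow_succ_apply_mem_iSup_exteriorPower hdeg n hx)
  · have h := LinearMap.congr_fun (IsNilpotent.exp_logOneAdd ⟨N, hN⟩) x
    rw [IsNilpotent.exp_eq_sum (IsNilpotent.logOneAdd_pow_eq_zero hN)] at h
    simp only [LinearMap.sum_apply, LinearMap.smul_apply] at h
    simp only [algebraMap_smul, h]
    simp [hδ]
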